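/- arXiv:1601.07293 — 2 statements merged into one kernel-verified Lean document; each statement's English description precedes it below -/
import Mathlib

section
/- Let φ: ℙ¹ → ℙ¹ be an endomorphism of degree d ≥ 2 defined over F_2(t) with good reduction at every finite place (i.e., at every place except possibly the place at infinity). If P ∈ ℙ¹(F_2(t)) is periodic for φ with minimal period n, then n ≤ 3. -/
set_option synthInstance.maxHeartbeats 1000000

noncomputable section

/-- The `v`-adic logarithmic distance between coordinate representatives of points of
`ℙ¹(K)`. -/
def logDist {K : Type} [Field K] (v : K → WithTop ℤ) (P Q : K × K) : WithTop ℤ :=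
  v (P.1 * Q.2 - Q.1 * P.2) - min (v P.1) (v P.2) - min (v Q.1) (v Q.2)

/-- Evaluation at a point of the pair of binary forms
`F(X,Y) = ∑ aᵢ Xⁱ Y^(d−i)`, `G(X,Y) = ∑ bᵢ Xⁱ Y^(d−i)` of degree `d`,
i.e. the map `φ([X:Y]) = [F(X,Y):G(X,Y)]` in homogeneous coordinates. -/
def evalPair {K : Type} [CommRing K] (d : ℕ) (a b : Fin (d+1) → K) (P : K × K) : K × K :=
  (∑ i : Fin (d+1), a i * P.1 ^ (i:ℕ) * P.2 ^ (d - (i:ℕ)),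
   ∑ i : Fin (d+1), b i * P.1 ^ (i:ℕ) * P.2 ^ (d - (i:ℕ)))

/-- The Sylvester matrix of the two binary forms of degree `d` with coefficient
vectors `a`, `b`. -/
def sylvester {K : Type} [CommRing K] (d : ℕ) (a b : Fin (d+1) → K) :
    Matrix (Fin (d+d)) (Fin (d+d)) K :=
  fun i j =>
    if _ : (i:ℕ) < d then
      if hj : (i:ℕ) ≤ (j:ℕ) ∧ (j:ℕ) ≤ (i:ℕ) + d then a ⟨(j:ℕ) - (i:ℕ), by omega⟩ else 0
    else
      if hj : (i:ℕ) - d ≤ (j:ℕ) ∧ (j:ℕ) ≤ (i:ℕ) then b ⟨(j:ℕ) - ((i:ℕ) - d), by omega⟩ else 0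

/-- The (homogeneous) resultant `Res(F,G)` of the two binary forms of degree `d`,
as the determinant of their Sylvester matrix. -/
def resultant {K : Type} [CommRing K] (d : ℕ) (a b : Fin (d+1) → K) : K :=
  (sylvester d a b).det

/-- The map `φ = [F:G]` has good reduction at the place `v`: after multiplying `F`
and `G` by a suitable nonzero scalar `u` (so as to be in `v`-reduced form: all
coefficients in the valuation ring of `v` and at least one of them a `v`-unit), the
resultant `Res(uF, uG)` is a `v`-unit. -/
def GoodReduction {K : Type} [Field K] (v : K → WithTop ℤ) (d : ℕ)
    (a b : Fin (d+1) → K) : Prop :=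
  ∃ u : K, u ≠ 0 ∧ (∀ i, 0 ≤ v (u * a i) ∧ 0 ≤ v (u * b i)) ∧
    ((∃ i, v (u * a i) = 0) ∨ (∃ i, v (u * b i) = 0)) ∧
    v (resultant d (fun i => u * a i) (fun i => u * b i)) = 0

open scoped Classical

/-- The valuation of `F_p(t)` attached to a monic irreducible polynomial `π` (a
finite place of `F_p(t)`). -/
def polyVal (p : ℕ) [Fact p.Prime] (π : Polynomial (ZMod p)) (f : RatFunc (ZMod p)) :
    WithTop ℤ :=
  if f = 0 then ⊤ else
    ((((UniqueFactorizationMonoid.normalizedFactors f.num).count π : ℤ) -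
      ((UniqueFactorizationMonoid.normalizedFactors f.denom).count π : ℤ) : ℤ) : WithTop ℤ)

/-- The determinant of two vectors in the plane. -/
def pairDet {R : Type} [CommRing R] (P Q : R × R) : R :=
  P.1 * Q.2 - Q.1 * P.2

theorem map_pairDet {R S : Type} [CommRing R] [CommRing S] (f : R →+* S) (P Q : R × R) :
    f (pairDet P Q) = pairDet (Prod.map f f P) (Prod.map f f Q) := by
  simp [pairDet]

theorem pairDet_smul_self {R : Type} [CommRing R] (c : R) (P : R × R) :
    pairDet P (c • P) = 0 := by
  simp only [pairDet, Prod.smul_fst, Prod.smul_snd, smul_eq_mul]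
  ring

theorem eq_smul_of_pairDet_eq_zero {R : Type} [CommRing R] {P Q : R × R}
    (hP : IsCoprime P.1 P.2) (h : pairDet P Q = 0) : ∃ u : R, Q = u • P := by
  obtain ⟨s, r, hsr⟩ := hP
  unfold pairDet at h
  refine ⟨s * Q.1 + r * Q.2, Prod.ext ?_ ?_⟩
  · simp only [Prod.smul_fst, smul_eq_mul]
    linear_combination (-r) * h - Q.1 * hsr
  · simp only [Prod.smul_snd, smul_eq_mul]
    linear_combination s * h - Q.2 * hsr

theorem pairDet_dvd_of_consecutive {R : Type} [CommRing R] {P Q T : R × R} {m : R}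
    (hQ : IsCoprime Q.1 Q.2) (hPQ : m ∣ pairDet P Q) (hQT : m ∣ pairDet Q T) :
    m ∣ pairDet P T := by
  obtain ⟨s, r, hsr⟩ := hQ
  have key : pairDet P T =
      (s * P.1 + r * P.2) * pairDet Q T + (s * T.1 + r * T.2) * pairDet P Q := by
    unfold pairDet
    linear_combination (-(P.1 * T.2 - T.1 * P.2)) * hsr
  rw [key]
  exact dvd_add (hQT.mul_left _) (hPQ.mul_left _)

theorem map_evalPair {R S : Type} [CommRing R] [CommRing S] (f : R →+* S) (d : ℕ)
    (a b : Fin (d + 1) → R) (P : R × R) :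
    Prod.map f f (evalPair d a b P) =
      evalPair d (fun i => f (a i)) (fun i => f (b i)) (Prod.map f f P) := by
  simp [evalPair]

theorem evalPair_smul {R : Type} [CommRing R] (d : ℕ) (a b : Fin (d + 1) → R) (c : R)
    (P : R × R) : evalPair d a b (c • P) = c ^ d • evalPair d a b P := by
  have h (e : Fin (d + 1) → R) :
      ∑ i : Fin (d + 1), e i * (c • P).1 ^ (i : ℕ) * (c • P).2 ^ (d - (i : ℕ)) =
        c ^ d * ∑ i : Fin (d + 1), e i * P.1 ^ (i : ℕ) * P.2 ^ (d - (i : ℕ)) := by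
    rw [Finset.mul_sum]
    refine Finset.sum_congr rfl fun i _ => ?_
    obtain ⟨k, hk⟩ := Nat.exists_eq_add_of_le (Nat.lt_succ_iff.mp i.2)
    have hd : d - (i : ℕ) = k := by omega
    rw [hd]
    have hc : c ^ d = c ^ (i : ℕ) * c ^ k := by rw [← pow_add, ← hk]
    simp only [Prod.smul_fst, Prod.smul_snd, smul_eq_mul, mul_pow, hc]
    ring
  exact Prod.ext (h a) (h b)

theorem evalPair_smul_coeff {R : Type} [CommRing R] (d : ℕ) (a b : Fin (d + 1) → R) (c : R)
    (P : R × R) :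
    evalPair d (fun i => c * a i) (fun i => c * b i) P = c • evalPair d a b P := by
  simp [evalPair, Finset.mul_sum, mul_assoc]

theorem pairDet_dvd_pairDet_evalPair {R : Type} [CommRing R] (d : ℕ)
    (a b : Fin (d + 1) → R) {P : R × R} (hP : IsCoprime P.1 P.2) (Q : R × R) :
    pairDet P Q ∣ pairDet (evalPair d a b P) (evalPair d a b Q) := by
  rw [← Ideal.mem_span_singleton, ← Ideal.Quotient.eq_zero_iff_mem, map_pairDet,
    map_evalPair, map_evalPair]
  set f := Ideal.Quotient.mk (Ideal.span {pairDet P Q})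
  have h0 : pairDet (Prod.map f f P) (Prod.map f f Q) = 0 := by
    rw [← map_pairDet, Ideal.Quotient.eq_zero_iff_mem]
    exact Ideal.mem_span_singleton_self _
  obtain ⟨u, hu⟩ := eq_smul_of_pairDet_eq_zero (P := Prod.map f f P) (hP.map f) h0
  rw [hu, evalPair_smul]
  exact pairDet_smul_self _ _

theorem map_resultant {R S : Type} [CommRing R] [CommRing S] (f : R →+* S) (d : ℕ)
    (a b : Fin (d + 1) → R) :
    f (resultant d a b) = resultant d (fun i => f (a i)) (fun i => f (b i)) := by
  unfold resultant
  rw [RingHom.map_det]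
  congr 1
  ext i j
  simp only [RingHom.mapMatrix_apply, Matrix.map_apply, sylvester]
  split_ifs <;> simp

theorem resultant_smul {R : Type} [CommRing R] (d : ℕ) (a b : Fin (d + 1) → R) (c : R) :
    resultant d (fun i => c * a i) (fun i => c * b i) = c ^ (d + d) * resultant d a b := by
  have h : sylvester d (fun i => c * a i) (fun i => c * b i) = c • sylvester d a b := by
    ext i j
    simp only [Matrix.smul_apply, smul_eq_mul, sylvester]
    split_ifs <;> simp
  unfold resultant
  rw [h, Matrix.det_smul, Fintype.card_fin]

theorem sum_shifted_coeff {R : Type} [CommRing R] {d i : ℕ} (hi : i < d)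
    (a : Fin (d + 1) → R) (x y : R) :
    ∑ j : Fin (d + d), (if hj : i ≤ (j : ℕ) ∧ (j : ℕ) ≤ i + d
        then a ⟨(j : ℕ) - i, by omega⟩ else 0) * (x ^ (j : ℕ) * y ^ (d + d - 1 - (j : ℕ))) =
      x ^ i * y ^ (d - 1 - i) *
        ∑ k : Fin (d + 1), a k * x ^ (k : ℕ) * y ^ (d - (k : ℕ)) := by
  rw [Finset.mul_sum]
  symm
  refine Fintype.sum_of_injective (fun k : Fin (d + 1) => (⟨i + k, by omega⟩ : Fin (d + d)))
    ?_ _ _ ?_ ?_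
  · intro k l h
    simp only [Fin.mk.injEq] at h
    exact Fin.ext (by omega)
  · intro j hj
    rw [dif_neg, zero_mul]
    rintro ⟨h1, h2⟩
    exact hj ⟨⟨j - i, by omega⟩, Fin.ext (by simp; omega)⟩
  · intro k
    have hk : i ≤ i + (k : ℕ) ∧ i + (k : ℕ) ≤ i + d := ⟨by omega, by omega⟩
    have he : d + d - 1 - (i + (k : ℕ)) = (d - 1 - i) + (d - k) := by omega
    simp only [hk, and_self, dite_true, he, Nat.add_sub_cancel_left, Fin.eta, pow_add]
    ring

theorem sylvester_mulVec {R : Type} [CommRing R] (d : ℕ) (a b : Fin (d + 1) → R)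
    (P : R × R) (i : Fin (d + d)) :
    (sylvester d a b).mulVec (fun j => P.1 ^ (j : ℕ) * P.2 ^ (d + d - 1 - (j : ℕ))) i =
      if (i : ℕ) < d then P.1 ^ (i : ℕ) * P.2 ^ (d - 1 - (i : ℕ)) * (evalPair d a b P).1
      else P.1 ^ ((i : ℕ) - d) * P.2 ^ (d - 1 - ((i : ℕ) - d)) * (evalPair d a b P).2 := by
  simp only [Matrix.mulVec, dotProduct, sylvester]
  by_cases hi : (i : ℕ) < d
  · simp only [hi, dite_true, if_true, evalPair]
    exact sum_shifted_coeff hi a P.1 P.2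
  · simp only [hi, dite_false, if_false, evalPair]
    have he : (i : ℕ) - d + d = i := by omega
    have := sum_shifted_coeff (i := (i : ℕ) - d) (by omega) b P.1 P.2
    simp only [he] at this
    exact this

theorem isCoprime_evalPair {R : Type} [CommRing R] {d : ℕ} (hd : 0 < d)
    {a b : Fin (d + 1) → R} (hres : IsUnit (resultant d a b)) {P : R × R}
    (hP : IsCoprime P.1 P.2) : IsCoprime (evalPair d a b P).1 (evalPair d a b P).2 := by
  set I : Ideal R := Ideal.span {(evalPair d a b P).1, (evalPair d a b P).2}
  have h1 : (evalPair d a b P).1 ∈ I := Ideal.subset_span (by simp)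
  have h2 : (evalPair d a b P).2 ∈ I := Ideal.subset_span (by simp)
  set w : Fin (d + d) → R := fun j => P.1 ^ (j : ℕ) * P.2 ^ (d + d - 1 - (j : ℕ)) with hw
  have hS (i : Fin (d + d)) : (sylvester d a b).mulVec w i ∈ I := by
    rw [hw, sylvester_mulVec]
    split_ifs
    · exact I.mul_mem_left _ h1
    · exact I.mul_mem_left _ h2
  have hwI (j : Fin (d + d)) : w j ∈ I := by
    have hadj : (sylvester d a b).adjugate.mulVec ((sylvester d a b).mulVec w) =
        resultant d a b • w := by
      rw [Matrix.mulVec_mulVec, Matrix.adjugate_mul, Matrix.smul_mulVec, Matrix.one_mulVec]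
      rfl
    have hmem : resultant d a b * w j ∈ I := by
      have := congrFun hadj j
      rw [Pi.smul_apply, smul_eq_mul] at this
      rw [← this]
      simp only [Matrix.mulVec, dotProduct] at hS ⊢
      exact I.sum_mem fun i _ => I.mul_mem_left _ (hS i)
    exact (Ideal.unit_mul_mem_iff_mem I hres).mp hmem
  have hx : P.1 ^ (d + d - 1) ∈ I := by
    simpa [hw] using hwI ⟨d + d - 1, by omega⟩
  have hy : P.2 ^ (d + d - 1) ∈ I := by
    simpa [hw] using hwI ⟨0, by omega⟩
  obtain ⟨s, r, hsr⟩ := hP.pow (m := d + d - 1) (n := d + d - 1)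
  have hone : (1 : R) ∈ I := hsr ▸ I.add_mem (I.mul_mem_left _ hx) (I.mul_mem_left _ hy)
  exact Ideal.mem_span_pair.mp hone

theorem isCoprime_iterate_evalPair {R : Type} [CommRing R] {d : ℕ} (hd : 0 < d)
    {a b : Fin (d + 1) → R} (hres : IsUnit (resultant d a b)) {P : R × R}
    (hP : IsCoprime P.1 P.2) (m : ℕ) :
    IsCoprime ((evalPair d a b)^[m] P).1 ((evalPair d a b)^[m] P).2 := by
  induction m with
  | zero => exact hP
  | succ m ih =>
    rw [Function.iterate_succ_apply']
    exact isCoprime_evalPair hd hres ih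

theorem eq_of_pairDet_eq_zero {R : Type} [CommRing R] [Subsingleton Rˣ] {P Q : R × R}
    (hP : IsCoprime P.1 P.2) (hQ : IsCoprime Q.1 Q.2) (h : pairDet P Q = 0) : P = Q := by
  obtain ⟨u, rfl⟩ := eq_smul_of_pairDet_eq_zero hP h
  obtain ⟨s, r, hsr⟩ := hQ
  have hu : IsUnit u := IsUnit.of_mul_eq_one (s * P.1 + r * P.2) (by
    simp only [Prod.smul_fst, Prod.smul_snd, smul_eq_mul] at hsr
    linear_combination hsr)
  rw [isUnit_iff_eq_one.mp hu, one_smul]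

theorem recurrence_ne_zero {F : Type} [Field F] {l : Polynomial F} (hl : 0 < l.natDegree)
    {g : ℕ → Polynomial F} (h0 : g 0 = 0) (h1 : g 1 ≠ 0)
    (hrec : ∀ i, g (i + 2) = l * g (i + 1) + g i) {n : ℕ} (hn : 0 < n) : g n ≠ 0 := by
  have hdeg (i : ℕ) : (g i).degree < (g (i + 1)).degree := by
    induction i with
    | zero =>
      rw [h0, Polynomial.degree_zero]
      exact bot_lt_iff_ne_bot.mpr (Polynomial.degree_ne_bot.mpr h1)
    | succ i ih =>
      have hne : g (i + 1) ≠ 0 := by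
        rintro h
        rw [h, Polynomial.degree_zero] at ih
        exact not_lt_bot ih
      have hlt : (g (i + 1)).degree < (l * g (i + 1)).degree := by
        have hl0 : l ≠ 0 := by
          rintro rfl
          simp at hl
        rw [Polynomial.degree_eq_natDegree hne,
          Polynomial.degree_eq_natDegree (mul_ne_zero hl0 hne),
          Polynomial.natDegree_mul hl0 hne]
        exact_mod_cast (by omega)
      rw [hrec, Polynomial.degree_add_eq_left_of_degree_lt (ih.trans hlt)]
      exact hlt
  obtain ⟨k, rfl⟩ := Nat.exists_eq_succ_of_ne_zero hn.ne'
  rintro h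
  have := hdeg k
  rw [Nat.succ_eq_add_one] at h
  rw [h, Polynomial.degree_zero] at this
  exact not_lt_bot this

theorem eq_of_dvd_succ_of_periodic {R : Type} [CommRing R] [IsDomain R] [Subsingleton Rˣ]
    {f : ℕ → R} {n : ℕ} (hn : 0 < n) (hdvd : ∀ i, f i ∣ f (i + 1))
    (hper : ∀ i, f (i + n) = f i) (i : ℕ) : f i = f 0 := by
  have hmono (i j : ℕ) : f i ∣ f (i + j) := by
    induction j with
    | zero => exact dvd_rfl
    | succ j ih => exact ih.trans (hdvd _)
  have hmul (k : ℕ) : f (k * n) = f 0 := by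
    induction k with
    | zero => simp
    | succ k ih => rw [Nat.succ_mul, hper, ih]
  have h1 : f 0 ∣ f i := by simpa using hmono 0 i
  have h2 : f i ∣ f 0 := by
    rw [← hmul i]
    have := hmono i (i * n - i)
    rwa [Nat.add_sub_cancel' (Nat.le_mul_of_pos_right i hn)] at this
  exact associated_iff_eq.mp (associated_of_dvd_dvd h2 h1)

instance subsingleton_units_polynomial_zmod_two : Subsingleton (Polynomial (ZMod 2))ˣ := by
  refine ⟨fun x y => Units.ext ?_⟩
  have h (z : (Polynomial (ZMod 2))ˣ) : (z : Polynomial (ZMod 2)) = 1 := by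
    obtain ⟨c, hc, hz⟩ := Polynomial.isUnit_iff.mp z.isUnit
    rw [← hz, isUnit_iff_eq_one.mp hc, map_one]
  rw [h x, h y]

theorem exists_period_le_three {d : ℕ} (hd : 0 < d)
    {a b : Fin (d + 1) → Polynomial (ZMod 2)} (hres : IsUnit (resultant d a b))
    {P : Polynomial (ZMod 2) × Polynomial (ZMod 2)} (hP : IsCoprime P.1 P.2) {n : ℕ}
    (hn : 0 < n) (hper : (evalPair d a b)^[n] P = P) :
    ∃ m, 0 < m ∧ m ≤ 3 ∧ (evalPair d a b)^[m] P = P := by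
  set f : ℕ → Polynomial (ZMod 2) × Polynomial (ZMod 2) := fun i => (evalPair d a b)^[i] P
    with hf
  have hcop (i : ℕ) : IsCoprime (f i).1 (f i).2 := isCoprime_iterate_evalPair hd hres hP i
  have hfper (i : ℕ) : f (i + n) = f i := by
    simp only [hf]
    rw [Function.iterate_add_apply, hper]
  have hdet (k i : ℕ) : pairDet (f i) (f (i + k)) = pairDet (f 0) (f k) := by
    have := eq_of_dvd_succ_of_periodic (f := fun i => pairDet (f i) (f (i + k))) hn ?_ ?_ i
    · simpa using this
    · intro i
      have := pairDet_dvd_pairDet_evalPair d a b (hcop i) (f (i + k))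
      simp only [hf] at this ⊢
      rwa [← Function.iterate_succ_apply' (evalPair d a b),
        ← Function.iterate_succ_apply' (evalPair d a b),
        show (i + k).succ = i + 1 + k by omega] at this
    · intro i
      rw [show i + n + k = i + k + n by omega, hfper, hfper]
  by_cases h1 : pairDet (f 0) (f 1) = 0
  · exact ⟨1, one_pos, by norm_num, (eq_of_pairDet_eq_zero (hcop 0) (hcop 1) h1).symm⟩
  have h12 : pairDet (f 1) (f 2) = pairDet (f 0) (f 1) := hdet 1 1
  obtain ⟨l, hl⟩ : pairDet (f 0) (f 1) ∣ pairDet (f 0) (f 2) :=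
    pairDet_dvd_of_consecutive (hcop 1) dvd_rfl h12.symm.dvd
  have hrec (i : ℕ) : f (i + 2) = l • f (i + 1) + f i := by
    have e1 := hdet 1 i
    have e2 := hdet 1 (i + 1)
    have e3 := (hdet 2 i).trans hl
    have htwo : (2 : Polynomial (ZMod 2)) = 0 := CharTwo.two_eq_zero
    rw [show i + 1 + 1 = i + 2 by omega] at e2
    set δ := pairDet (f 0) (f 1)
    unfold pairDet at e1 e2 e3
    refine Prod.ext (mul_left_cancel₀ h1 ?_) (mul_left_cancel₀ h1 ?_)
    · simp only [Prod.fst_add, Prod.smul_fst, smul_eq_mul]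
      linear_combination (f (i + 1)).1 * e3 - (f (i + 2)).1 * e1 - (f i).1 * e2 - δ * (f i).1 * htwo
    · simp only [Prod.snd_add, Prod.smul_snd, smul_eq_mul]
      linear_combination (f (i + 1)).2 * e3 - (f (i + 2)).2 * e1 - (f i).2 * e2 - δ * (f i).2 * htwo
  have hl0 : l.natDegree = 0 := by
    by_contra hpos
    refine recurrence_ne_zero (g := fun i => pairDet (f 0) (f i)) (Nat.pos_of_ne_zero hpos)
      ?_ h1 ?_ hn ?_
    · simp [pairDet]
    · intro i
      simp only [hrec i, pairDet, Prod.fst_add, Prod.snd_add, Prod.smul_fst, Prod.smul_snd,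
        smul_eq_mul]
      ring
    · have : f n = f 0 := by simpa using hfper 0
      simp only [this, pairDet]
      ring
  obtain ⟨c, rfl⟩ := Polynomial.natDegree_eq_zero.mp hl0
  have hc : c = 0 ∨ c = 1 := by
    clear hl hrec hl0
    revert c
    decide
  rcases hc with rfl | rfl
  · exact ⟨2, two_pos, by norm_num, by simpa [hf] using hrec 0⟩
  · refine ⟨3, three_pos, le_rfl, ?_⟩
    have e0 := hrec 0
    have e1 := hrec 1
    simp only [map_one, one_smul, zero_add] at e0 e1
    change f 3 = f 0
    rw [show f 3 = f (1 + 2) from rfl, e1, show f (1 + 1) = f 2 from rfl, e0, add_right_comm]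
    refine Prod.ext ?_ ?_ <;> simp [CharTwo.add_self_eq_zero]

theorem count_normalizedFactors_pos_iff {p : ℕ} [Fact p.Prime] {π q : Polynomial (ZMod p)}
    (hm : π.Monic) (hπ : Irreducible π) (hq : q ≠ 0) :
    0 < (UniqueFactorizationMonoid.normalizedFactors q).count π ↔ π ∣ q := by
  rw [Multiset.count_pos, UniqueFactorizationMonoid.mem_normalizedFactors_iff' hq]
  simp [hπ, hm.normalize_eq_self]

theorem not_dvd_denom_of_polyVal_nonneg {p : ℕ} [Fact p.Prime] {π : Polynomial (ZMod p)}
    (hm : π.Monic) (hπ : Irreducible π) {f : RatFunc (ZMod p)} (h : 0 ≤ polyVal p π f) :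
    ¬ π ∣ f.denom := by
  intro hdvd
  have hnum : ¬ π ∣ f.num := fun h' =>
    hπ.not_isUnit (f.isCoprime_num_denom.isUnit_of_dvd' h' hdvd)
  have hf : f ≠ 0 := by
    rintro rfl
    simp at hnum
  have hd := (count_normalizedFactors_pos_iff hm hπ f.denom_ne_zero).mpr hdvd
  have hn := mt (count_normalizedFactors_pos_iff hm hπ (RatFunc.num_ne_zero hf)).mp hnum
  rw [polyVal, if_neg hf] at h
  have h' := WithTop.coe_le_coe.mp h
  omega

theorem not_dvd_num_of_polyVal_eq_zero {p : ℕ} [Fact p.Prime] {π : Polynomial (ZMod p)}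
    (hm : π.Monic) (hπ : Irreducible π) {f : RatFunc (ZMod p)} (h : polyVal p π f = 0) :
    ¬ π ∣ f.num := by
  intro hdvd
  have hden := not_dvd_denom_of_polyVal_nonneg hm hπ h.ge
  have hf : f ≠ 0 := by
    rintro rfl
    simp [polyVal] at h
  have hn := (count_normalizedFactors_pos_iff hm hπ (RatFunc.num_ne_zero hf)).mpr hdvd
  have hd := mt (count_normalizedFactors_pos_iff hm hπ f.denom_ne_zero).mp hden
  rw [polyVal, if_neg hf] at h
  have h' := WithTop.coe_eq_coe.mp h
  omega

theorem exists_primitive_multiple {R K ι : Type} [CommRing R] [IsDomain R]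
    [IsPrincipalIdealRing R] [Field K] [Algebra R K] [IsFractionRing R K] [Finite ι]
    {c : ι → K} (hc : ∃ i, c i ≠ 0) :
    ∃ u : K, u ≠ 0 ∧ ∃ c' : ι → R, (∀ i, algebraMap R K (c' i) = u * c i) ∧
      ∀ π : R, Irreducible π → ∃ i, ¬ π ∣ c' i := by
  obtain ⟨s, hs⟩ := IsLocalization.exist_integer_multiples_of_finite (nonZeroDivisors R) c
  choose e he using hs
  have hs0 : algebraMap R K s ≠ 0 :=
    IsFractionRing.to_map_ne_zero_of_mem_nonZeroDivisors s.2
  set I : Ideal R := Ideal.span (Set.range e)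
  set g : R := Submodule.IsPrincipal.generator I
  have hgI : Ideal.span {g} = I := Ideal.span_singleton_generator I
  have hdvd (i : ι) : g ∣ e i := by
    rw [← Ideal.mem_span_singleton, hgI]
    exact Ideal.subset_span ⟨i, rfl⟩
  choose c' hc' using hdvd
  have hg0 : g ≠ 0 := by
    intro hg
    obtain ⟨i, hi⟩ := hc
    have := he i
    rw [hc' i, hg, zero_mul, map_zero, Algebra.smul_def] at this
    exact mul_ne_zero hs0 hi this.symm
  have hg0' : algebraMap R K g ≠ 0 := by
    simpa using (IsFractionRing.injective R K).ne hg0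
  refine ⟨algebraMap R K s / algebraMap R K g, div_ne_zero hs0 hg0', c', fun i => ?_, ?_⟩
  · have := he i
    rw [hc' i, map_mul, Algebra.smul_def] at this
    rw [div_mul_eq_mul_div, eq_div_iff hg0', mul_comm, this]
  · intro π hπ
    by_contra! hall
    have hle : I ≤ Ideal.span {g * π} := by
      rw [Ideal.span_le]
      rintro _ ⟨i, rfl⟩
      rw [SetLike.mem_coe, Ideal.mem_span_singleton, hc' i]
      exact mul_dvd_mul_left _ (hall i)
    have hmem : g ∈ Ideal.span {g * π} := hle (Submodule.IsPrincipal.generator_mem I)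
    rw [Ideal.mem_span_singleton] at hmem
    have : g * π ∣ g * 1 := by rwa [mul_one]
    exact hπ.not_isUnit (isUnit_of_dvd_one ((mul_dvd_mul_iff_left hg0).mp this))

theorem GoodReduction.not_dvd_resultant {p : ℕ} [Fact p.Prime] {π : Polynomial (ZMod p)}
    (hm : π.Monic) (hπ : Irreducible π) {d : ℕ} {a b : Fin (d + 1) → RatFunc (ZMod p)}
    (hgood : GoodReduction (polyVal p π) d a b) {u : RatFunc (ZMod p)}
    {a' b' : Fin (d + 1) → Polynomial (ZMod p)}
    (ha : ∀ i, algebraMap _ (RatFunc (ZMod p)) (a' i) = u * a i)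
    (hb : ∀ i, algebraMap _ (RatFunc (ZMod p)) (b' i) = u * b i)
    (hprim : (∃ i, ¬ π ∣ a' i) ∨ ∃ i, ¬ π ∣ b' i) : ¬ π ∣ resultant d a' b' := by
  intro hdvd
  obtain ⟨w, -, hnonneg, -, hres⟩ := hgood
  have hπ' : Prime π := hπ.prime
  set ι := algebraMap (Polynomial (ZMod p)) (RatFunc (ZMod p)) with hι
  have hfrac (f : RatFunc (ZMod p)) : f * ι f.denom = ι f.num := by
    have h0 : ι f.denom ≠ 0 := RatFunc.algebraMap_ne_zero f.denom_ne_zero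
    rw [← eq_div_iff h0]
    exact (RatFunc.num_div_denom f).symm
  have hscale : ∃ s q : Polynomial (ZMod p), ¬ π ∣ s ∧ w * ι s = u * ι q := by
    have aux (c : RatFunc (ZMod p)) (c' : Polynomial (ZMod p)) (hc : ι c' = u * c)
        (hc' : ¬ π ∣ c') (hv : 0 ≤ polyVal p π (w * c)) :
        ∃ s q : Polynomial (ZMod p), ¬ π ∣ s ∧ w * ι s = u * ι q := by
      refine ⟨c' * (w * c).denom, (w * c).num, ?_, ?_⟩
      · rw [hπ'.dvd_mul, not_or]
        exact ⟨hc', not_dvd_denom_of_polyVal_nonneg hm hπ hv⟩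
      · rw [map_mul, hc, ← hfrac]
        ring
    rcases hprim with ⟨i, hi⟩ | ⟨i, hi⟩
    · exact aux _ _ (ha i) hi (hnonneg i).1
    · exact aux _ _ (hb i) hi (hnonneg i).2
  obtain ⟨s, q, hs, hsq⟩ := hscale
  set f := resultant d (fun i => w * a i) (fun i => w * b i) with hf
  have hf1 : f = w ^ (d + d) * resultant d a b := resultant_smul d a b w
  have hf2 : ι (resultant d a' b') = u ^ (d + d) * resultant d a b := by
    rw [map_resultant, funext ha, funext hb, resultant_smul]
  have key : s ^ (d + d) * f.num = q ^ (d + d) * resultant d a' b' * f.denom := by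
    apply RatFunc.algebraMap_injective
    simp only [map_mul, map_pow, ← hι]
    rw [← hfrac f, hf2]
    nth_rewrite 1 [hf1]
    linear_combination (resultant d a b * ι f.denom) * congrArg (· ^ (d + d)) hsq
  have hdiv : π ∣ s ^ (d + d) * f.num := by
    rw [key]
    exact (hdvd.mul_left _).mul_right _
  rcases hπ'.dvd_mul.mp hdiv with h | h
  · exact hs (hπ'.dvd_of_dvd_pow h)
  · exact not_dvd_num_of_polyVal_eq_zero hm hπ hres h

theorem exists_iterate_evalPair_eq_smul_map {R K : Type} [CommRing R] [Field K]
    (f : R →+* K) {d : ℕ} {a b : Fin (d + 1) → K} {a' b' : Fin (d + 1) → R} {u : K}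
    (hu : u ≠ 0) (ha : ∀ i, f (a' i) = u * a i) (hb : ∀ i, f (b' i) = u * b i)
    {P : K × K} {Q : R × R} {e : K} (he : e ≠ 0) (hPQ : P = e • Prod.map f f Q) (m : ℕ) :
    ∃ c : K, c ≠ 0 ∧
      (evalPair d a b)^[m] P = c • Prod.map f f ((evalPair d a' b')^[m] Q) := by
  induction m with
  | zero => exact ⟨e, he, hPQ⟩
  | succ m ih =>
    obtain ⟨c, hc, ih⟩ := ih
    refine ⟨c ^ d * u⁻¹, mul_ne_zero (pow_ne_zero _ hc) (inv_ne_zero hu), ?_⟩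
    rw [Function.iterate_succ_apply', Function.iterate_succ_apply', ih, evalPair_smul,
      map_evalPair, funext ha, funext hb, evalPair_smul_coeff, smul_smul,
      inv_mul_cancel_right₀ hu]

/-- Let `φ = [F:G]` be an endomorphism of `ℙ¹` of degree `d ≥ 2` defined over
`F_2(t)` with good reduction at every finite place (every place attached to a monic
irreducible polynomial of `F_2[t]`).  If `P ∈ ℙ¹(F_2(t))` is periodic for `φ` with
minimal period `n`, then `n ≤ 3`. -/
theorem minimal_period_le_three_char_two (d : ℕ) (hd : 2 ≤ d)
    (a b : Fin (d+1) → RatFunc (ZMod 2))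
    (hgood : ∀ π : Polynomial (ZMod 2), π.Monic → Irreducible π →
      GoodReduction (polyVal 2 π) d a b)
    (P : RatFunc (ZMod 2) × RatFunc (ZMod 2)) (hP : P ≠ (0, 0))
    (n : ℕ) (hn : 0 < n)
    (hper : ∃ c : RatFunc (ZMod 2), c ≠ 0 ∧ (evalPair d a b)^[n] P = c • P)
    (hmin : ∀ m : ℕ, 0 < m →
      (∃ c : RatFunc (ZMod 2), c ≠ 0 ∧ (evalPair d a b)^[m] P = c • P) → n ≤ m) :
    n ≤ 3 := by
  set ι := algebraMap (Polynomial (ZMod 2)) (RatFunc (ZMod 2)) with hι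
  have hcoeff : ∃ i, Sum.elim a b i ≠ 0 := by
    obtain ⟨u, -, -, h, -⟩ := hgood Polynomial.X Polynomial.monic_X Polynomial.irreducible_X
    have hv (c : RatFunc (ZMod 2)) (h : polyVal 2 Polynomial.X (u * c) = 0) : c ≠ 0 := by
      rintro rfl
      simp [polyVal] at h
    rcases h with ⟨i, hi⟩ | ⟨i, hi⟩
    · exact ⟨Sum.inl i, hv _ hi⟩
    · exact ⟨Sum.inr i, hv _ hi⟩
  obtain ⟨u, hu, ab, hab, hprim⟩ :=
    exists_primitive_multiple (R := Polynomial (ZMod 2)) hcoeff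
  have ha (i) : ι (ab (Sum.inl i)) = u * a i := hab (Sum.inl i)
  have hb (i) : ι (ab (Sum.inr i)) = u * b i := hab (Sum.inr i)
  have hres : IsUnit (resultant d (fun i => ab (Sum.inl i)) (fun i => ab (Sum.inr i))) := by
    by_contra hnu
    obtain ⟨π, hm, hπ, hdvd⟩ := Polynomial.exists_monic_irreducible_factor _ hnu
    exact (hgood π hm hπ).not_dvd_resultant hm hπ ha hb (Sum.exists.mp (hprim π hπ)) hdvd
  have hP' : ∃ i, ![P.1, P.2] i ≠ 0 := by
    by_contra! h
    exact hP (Prod.ext (h 0) (h 1))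
  obtain ⟨e, he, Q, hQ, hQprim⟩ :=
    exists_primitive_multiple (R := Polynomial (ZMod 2)) hP'
  have hcop : IsCoprime (Q 0, Q 1).1 (Q 0, Q 1).2 := by
    refine isCoprime_of_irreducible_dvd ?_ ?_
    · rintro ⟨h0, h1⟩
      obtain ⟨i, hi⟩ := hQprim _ Polynomial.irreducible_X
      fin_cases i <;> simp_all
    · intro π hπ h0 h1
      obtain ⟨i, hi⟩ := hQprim π hπ
      fin_cases i <;> contradiction
  have hPQ : Prod.map ι ι (Q 0, Q 1) = e • P := Prod.ext (hQ 0) (hQ 1)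
  have hPQ' : P = e⁻¹ • Prod.map ι ι (Q 0, Q 1) := by
    rw [hPQ, smul_smul, inv_mul_cancel₀ he, one_smul]
  have hiter := exists_iterate_evalPair_eq_smul_map ι hu ha hb (inv_ne_zero he) hPQ'
  have hQper : (evalPair d (fun i => ab (Sum.inl i)) (fun i => ab (Sum.inr i)))^[n]
      (Q 0, Q 1) = (Q 0, Q 1) := by
    obtain ⟨c, hc, hc'⟩ := hper
    obtain ⟨k, hk, hk'⟩ := hiter n
    refine (eq_of_pairDet_eq_zero hcop
      (isCoprime_iterate_evalPair (by omega) hres hcop n) ?_).symm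
    apply RatFunc.algebraMap_injective
    rw [← hι, map_pairDet, hPQ, map_zero]
    rw [hk'] at hc'
    have h1 := congrArg Prod.fst hc'
    have h2 := congrArg Prod.snd hc'
    simp only [Prod.smul_fst, Prod.smul_snd, smul_eq_mul] at h1 h2
    apply mul_left_cancel₀ hk
    simp only [pairDet, Prod.smul_fst, Prod.smul_snd, smul_eq_mul]
    linear_combination e * P.1 * h2 - e * P.2 * h1
  obtain ⟨m, hm, hm3, hmper⟩ := exists_period_le_three (by omega) hres hcop hn hQper
  obtain ⟨k, hk, hk'⟩ := hiter m
  refine (hmin m hm ⟨k * e, mul_ne_zero hk he, ?_⟩).trans hm3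
  rw [hk', hmper, hPQ, smul_smul]
end
end

section
/- Let K be a function field of degree D over F_p(t) and S a nonempty finite set of places of K. Let P₀, …, P_{n−1} ∈ ℙ¹(K) be n distinct points such that δ_v(P₀, P₁) = δ_v(P_i, P_j) for all distinct 0 ≤ i, j ≤ n−1 and all places v ∉ S. Then n ≤ (p|S|)^{2D}. -/
noncomputable section

/-- `v` is (the normalized additive valuation of) a place of the function field `K`
over `F_p(t)`: a surjective discrete valuation on `K`, trivial on the constants. -/
def IsPlace (p : ℕ) [Fact p.Prime] (K : Type) [Field K]
    [Algebra (RatFunc (ZMod p)) K] (v : K → WithTop ℤ) : Prop :=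
  v 0 = ⊤ ∧ (∀ x : K, x ≠ 0 → v x ≠ ⊤) ∧
    (∀ x y : K, v (x * y) = v x + v y) ∧
    (∀ x y : K, min (v x) (v y) ≤ v (x + y)) ∧
    (∀ c : ZMod p, c ≠ 0 → v (algebraMap (RatFunc (ZMod p)) K (RatFunc.C c)) = 0) ∧
    (∀ z : ℤ, ∃ x : K, v x = (z : WithTop ℤ))

open scoped Polynomial

theorem linearIndependent_of_quotient {A F S K ι : Type*} [CommRing A] [IsDedekindDomain A]
    [Field F] [Algebra A F] [IsFractionRing A F] [CommRing S] [Algebra A S] [Field K]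
    [Algebra F K] [Algebra A K] [Algebra S K] [IsScalarTower A F K] [IsScalarTower A S K]
    (hinj : Function.Injective (algebraMap S K)) {I : Ideal A} (hI : I ≠ ⊤) {b : ι → S}
    (hb : LinearIndependent (A ⧸ I)
      fun i ↦ Ideal.Quotient.mk (I.map (algebraMap A S)) (b i)) :
    LinearIndependent F fun i ↦ algebraMap S K (b i) := by
  contrapose! hb
  simp only [linearIndependent_iff', not_forall] at hb ⊢
  obtain ⟨s, g, hg, j, hjs, hj⟩ := hb
  obtain ⟨a, hint, k, hks, hk⟩ := Ideal.exist_integer_multiples_notMem hI s g hjs hj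
  choose! c hc using hint
  refine ⟨s, fun i ↦ Ideal.Quotient.mk I (c i), ?_, k, hks, fun h0 ↦ hk ?_⟩
  · have hzero : ∑ i ∈ s, algebraMap A S (c i) * b i = 0 := by
      apply hinj
      have hterm : ∀ i ∈ s, algebraMap S K (algebraMap A S (c i) * b i) =
          a • g i • algebraMap S K (b i) := by
        intro i hi
        rw [map_mul, ← IsScalarTower.algebraMap_apply, IsScalarTower.algebraMap_apply A F K,
          hc i hi, Algebra.smul_def, Algebra.smul_def, map_mul, mul_assoc]
      rw [map_sum, Finset.sum_congr rfl hterm, ← Finset.smul_sum, hg, smul_zero, map_zero]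
    have hmk : ∀ i, Ideal.Quotient.mk I (c i) •
        Ideal.Quotient.mk (I.map (algebraMap A S)) (b i) =
        Ideal.Quotient.mk (I.map (algebraMap A S)) (algebraMap A S (c i) * b i) := by
      intro i
      rw [Algebra.smul_def, map_mul]
      rfl
    simp only [hmk, ← map_sum, hzero, map_zero]
  · rw [← hc k hks]
    exact FractionalIdeal.mem_coeIdeal_of_mem _ (Ideal.Quotient.eq_zero_iff_mem.mp h0)

/-- The fibre over a maximal ideal with finite residue field is finite, even if `S` is not a
finite `A`-algebra. -/
theorem finite_quotient_map_and_card_le {A F S K : Type*} [CommRing A] [IsDedekindDomain A]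
    [Field F] [Algebra A F] [IsFractionRing A F] [CommRing S] [Algebra A S] [Field K]
    [Algebra F K] [Algebra A K] [Algebra S K] [IsScalarTower A F K] [IsScalarTower A S K]
    [FiniteDimensional F K] (hinj : Function.Injective (algebraMap S K))
    (I : Ideal A) [I.IsMaximal] [Finite (A ⧸ I)] :
    Finite (S ⧸ I.map (algebraMap A S)) ∧
      Nat.card (S ⧸ I.map (algebraMap A S)) ≤ Nat.card (A ⧸ I) ^ Module.finrank F K := by
  let := Ideal.Quotient.field I
  let B := Module.Basis.ofVectorSpace (A ⧸ I) (S ⧸ I.map (algebraMap A S))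
  choose b hb using fun i ↦ Ideal.Quotient.mk_surjective (B i)
  have hli : LinearIndependent F fun i ↦ algebraMap S K (b i) := by
    refine linearIndependent_of_quotient hinj (I := I) (Ideal.IsMaximal.ne_top ‹_›) ?_
    simp only [hb]
    exact B.linearIndependent
  have := hli.finite
  have := Fintype.ofFinite (Module.Basis.ofVectorSpaceIndex (A ⧸ I) (S ⧸ I.map (algebraMap A S)))
  have : Module.Finite (A ⧸ I) (S ⧸ I.map (algebraMap A S)) := Module.Finite.of_basis B
  refine ⟨Module.finite_of_finite (A ⧸ I), ?_⟩
  rw [Module.natCard_eq_pow_finrank (K := A ⧸ I), Module.finrank_eq_card_basis B]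
  exact Nat.pow_le_pow_right Nat.card_pos hli.fintype_card_le_finrank

theorem ValuationSubring.isDiscreteValuationRing_of_finite {A K : Type*} [CommRing A] [IsDomain A]
    [IsPrincipalIdealRing A] [Field K] (V : ValuationSubring K) [Algebra A V]
    [Algebra.IsAlgebraic A V] (hA : Function.Injective (algebraMap A V)) {f : A} (hf : Prime f)
    (hfV : algebraMap A V f ∈ IsLocalRing.maximalIdeal V)
    [Finite (V ⧸ (Ideal.span {f}).map (algebraMap A V))] : IsDiscreteValuationRing V := by
  have hmax : (Ideal.span {f}).IsMaximal :=
    PrincipalIdealRing.isMaximal_of_irreducible hf.irreducible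
  have hfield : ¬ IsField V := by
    rw [IsLocalRing.isField_iff_maximalIdeal_eq]
    intro h
    rw [h, Ideal.mem_bot, map_eq_zero_iff _ hA] at hfV
    exact hf.ne_zero hfV
  have : IsNoetherianRing V := by
    refine IsNoetherianRing.of_prime_ne_bot fun P hP hP0 ↦ ?_
    obtain ⟨x, hx, hx0⟩ := Submodule.exists_mem_ne_zero_of_ne_bot hP0
    have hcomap := Ideal.comap_ne_bot_of_algebraic_mem hx0 hx
      (Algebra.IsAlgebraic.isAlgebraic (R := A) x)
    have hPf : (Ideal.span {f}).map (algebraMap A V) ≤ P := by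
      rw [Ideal.map_le_iff_le_comap]
      have hm : Ideal.span {f} = (IsLocalRing.maximalIdeal V).comap (algebraMap A V) := by
        refine hmax.eq_of_le (Ideal.IsPrime.ne_top inferInstance) ?_
        rwa [Ideal.span_singleton_le_iff_mem]
      have hmaxP : (P.comap (algebraMap A V)).IsMaximal :=
        Ring.DimensionLEOne.maximalOfPrime hcomap (hP.comap (algebraMap A V))
      refine (hmaxP.eq_of_le hmax.ne_top ?_).ge
      rw [hm]
      exact Ideal.comap_mono (IsLocalRing.le_maximalIdeal hP.ne_top)
    refine Submodule.fg_of_fg_map_of_fg_inf_ker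
      (Submodule.mkQ ((Ideal.span {f}).map (algebraMap A V)))
      Submodule.FG.of_finite ?_
    rw [Submodule.ker_mkQ, inf_eq_right.mpr hPf, Ideal.map_span, Set.image_singleton]
    exact Submodule.fg_span_singleton _
  have hiff : IsDiscreteValuationRing V ↔ ValuationRing V :=
    (IsDiscreteValuationRing.TFAE V hfield).out 0 1
  exact hiff.mpr inferInstance

/-- A prime of `A` extends to a discrete valuation ring of a finite, possibly inseparable,
extension of the fraction field of `A`. -/
theorem exists_discrete_valuationSubring {A F K : Type*} [CommRing A] [IsDomain A]
    [IsPrincipalIdealRing A] [Field F] [Algebra A F] [IsFractionRing A F] [Field K]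
    [Algebra F K] [Algebra A K] [IsScalarTower A F K] [FiniteDimensional F K]
    {f : A} (hf : Prime f) [Finite (A ⧸ Ideal.span {f})] :
    ∃ V : ValuationSubring K, IsDiscreteValuationRing V ∧ (∀ a, algebraMap A K a ∈ V) ∧
      algebraMap A K f ∈ V.nonunits ∧ Finite (IsLocalRing.ResidueField V) ∧
      Nat.card (IsLocalRing.ResidueField V) ≤
        Nat.card (A ⧸ Ideal.span {f}) ^ Module.finrank F K := by
  have hAK : Function.Injective (algebraMap A K) := by
    rw [IsScalarTower.algebraMap_eq A F K]
    exact (algebraMap F K).injective.comp (IsFractionRing.injective A F)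
  have hmax : (Ideal.span {f}).IsMaximal :=
    PrincipalIdealRing.isMaximal_of_irreducible hf.irreducible
  let e : A ≃+* (algebraMap A K).range :=
    RingEquiv.ofBijective (algebraMap A K).rangeRestrict
      ⟨fun _ _ h ↦ hAK (congrArg Subtype.val h), (algebraMap A K).rangeRestrict_surjective⟩
  have hmem : f ∈ Ideal.span {f} := Ideal.mem_span_singleton_self f
  obtain ⟨V, hAV, hV⟩ := Ideal.image_subset_nonunits_valuationSubring
    ((Ideal.span {f}).comap (e.symm : (algebraMap A K).range →+* A)) (Ideal.comap_ne_top _ hmax.ne_top)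
  have hAV' : ∀ a, algebraMap A K a ∈ V := fun a ↦ hAV ⟨a, rfl⟩
  have hfV : algebraMap A K f ∈ V.nonunits :=
    hV ⟨e f, by simp [hmem], rfl⟩
  let : Algebra A V := ((algebraMap A K).codRestrict V.toSubring hAV').toAlgebra
  have : IsScalarTower A V K := .of_algebraMap_eq fun _ ↦ rfl
  have hinj : Function.Injective (algebraMap V K) := V.subtype_injective
  have : Algebra.IsAlgebraic A K :=
    (IsFractionRing.comap_isAlgebraic_iff (K := F)).mpr inferInstance
  have : Algebra.IsAlgebraic A V :=
    Algebra.IsAlgebraic.of_injective (IsScalarTower.toAlgHom A V K) hinj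
  obtain ⟨hfin, hcard⟩ := finite_quotient_map_and_card_le (F := F) hinj (Ideal.span {f})
  have hfm : algebraMap A V f ∈ IsLocalRing.maximalIdeal V := by
    obtain ⟨_, h⟩ := ValuationSubring.mem_nonunits_iff_exists_mem_maximalIdeal.mp hfV
    exact h
  have hle : (Ideal.span {f}).map (algebraMap A V) ≤ IsLocalRing.maximalIdeal V := by
    rwa [Ideal.map_span, Set.image_singleton, Ideal.span_singleton_le_iff_mem]
  have hsurj := Ideal.Quotient.factor_surjective hle
  have hAinj : Function.Injective (algebraMap A V) := fun _ _ h ↦ hAK (congrArg (algebraMap V K) h)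
  refine ⟨V, V.isDiscreteValuationRing_of_finite hAinj hf hfm, hAV', hfV,
    Finite.of_surjective _ hsurj, (Nat.card_le_card_of_surjective _ hsurj).trans hcard⟩

theorem exists_card_lt_irreducible_natDegree_le (p : ℕ) [Fact p.Prime] {d s : ℕ} (hd : d ≠ 0)
    (h : d * s < p ^ d) :
    ∃ T : Finset (ZMod p)[X], s < T.card ∧
      ∀ f ∈ T, f.Monic ∧ Irreducible f ∧ f.natDegree ≤ d := by
  classical
  have := Fintype.ofFinite (GaloisField p d)
  refine ⟨Finset.univ.image (minpoly (ZMod p) : GaloisField p d → _), ?_, ?_⟩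
  · have hle := Finset.card_le_mul_card_image (f := (minpoly (ZMod p) : GaloisField p d → _))
      (Finset.univ : Finset (GaloisField p d)) d fun g hg ↦ by
        obtain ⟨x, -, rfl⟩ := Finset.mem_image.mp hg
        have hdeg : (minpoly (ZMod p) x).natDegree ≤ d :=
          (minpoly.natDegree_le x).trans_eq (GaloisField.finrank p hd)
        let r := ((minpoly (ZMod p) x).map (algebraMap (ZMod p) (GaloisField p d))).roots
        have hr : r.card ≤ d :=
          (Polynomial.card_roots' _).trans (Polynomial.natDegree_map_le.trans hdeg)
        refine (Finset.card_le_card fun y hy ↦ ?_).trans ((Multiset.toFinset_card_le r).trans hr)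
        rw [Finset.mem_filter] at hy
        rw [Multiset.mem_toFinset, Polynomial.mem_roots_map
          (minpoly.ne_zero (Algebra.IsIntegral.isIntegral (R := ZMod p) x)), ← hy.2]
        exact minpoly.aeval _ y
    rw [Finset.card_univ, ← Nat.card_eq_fintype_card, GaloisField.card p d hd] at hle
    exact Nat.lt_of_mul_lt_mul_left (h.trans_le hle)
  · intro f hf
    obtain ⟨x, -, rfl⟩ := Finset.mem_image.mp hf
    have hx : IsIntegral (ZMod p) x := Algebra.IsIntegral.isIntegral x
    exact ⟨minpoly.monic hx, minpoly.irreducible hx,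
      (minpoly.natDegree_le x).trans_eq (GaloisField.finrank p hd)⟩

theorem sq_le_two_pow {k : ℕ} (hk : 4 ≤ k) : k ^ 2 ≤ 2 ^ k := by
  induction k, hk using Nat.le_induction with
  | base => norm_num
  | succ k hk ih =>
    rw [pow_succ 2 k]
    nlinarith

theorem exists_mul_lt_pow_lt_sq {p s : ℕ} (hp : 2 ≤ p) (hs : 0 < s) :
    ∃ d, d ≠ 0 ∧ d * s < p ^ d ∧ p ^ d < (p * s) ^ 2 := by
  have hp0 : 0 < p := by omega
  have h1 : p ^ 1 < (p * s) ^ 2 := by nlinarith [Nat.mul_le_mul hp hs, Nat.mul_le_mul hs hs]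
  have hbound : ∀ k, p ^ k < (p * s) ^ 2 → k ≤ (p * s) ^ 2 := fun k hk ↦
    ((Nat.lt_pow_self hp).trans hk).le
  let d := Nat.findGreatest (fun k ↦ p ^ k < (p * s) ^ 2) ((p * s) ^ 2)
  have hd : p ^ d < (p * s) ^ 2 :=
    Nat.findGreatest_spec (P := fun k ↦ p ^ k < (p * s) ^ 2) (hbound 1 h1) h1
  have hd1 : 1 ≤ d := Nat.le_findGreatest (hbound 1 h1) h1
  have hd2 : (p * s) ^ 2 ≤ p ^ (d + 1) := by
    by_contra! h
    have := Nat.le_findGreatest (P := fun k ↦ p ^ k < (p * s) ^ 2) (hbound _ h) h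
    omega
  have hd3 : p * s ^ 2 ≤ p ^ d := by
    rw [pow_succ p d] at hd2
    nlinarith
  have hd4 : d < p * s := by
    by_contra! h
    have hlt : p ^ d < d ^ 2 := hd.trans_le (Nat.pow_le_pow_left h 2)
    have hlt2 : 2 ^ d < d ^ 2 := (Nat.pow_le_pow_left hp d).trans_lt hlt
    have hd5 : d < 4 := by
      by_contra! h4
      exact absurd (sq_le_two_pow h4) (by omega)
    interval_cases d
    · omega
    · omega
    · have hps : p * s = 3 := by
        have := Nat.pow_le_pow_left hp 3
        nlinarith
      have hp3 : p = 3 := by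
        have := (Nat.dvd_prime Nat.prime_three).mp (Dvd.intro s hps)
        omega
      rw [hps, hp3] at hd
      omega
  refine ⟨d, by omega, ?_, hd⟩
  nlinarith

/-- The valuation of a discrete valuation subring, in additive notation. -/
theorem ValuationSubring.exists_addValuation {K : Type*} [Field K] (V : ValuationSubring K)
    [IsDiscreteValuationRing V] :
    ∃ v : K → WithTop ℤ, v 0 = ⊤ ∧ (∀ x, x ≠ 0 → v x ≠ ⊤) ∧ (∀ x y, v (x * y) = v x + v y) ∧
      (∀ x y, min (v x) (v y) ≤ v (x + y)) ∧ (∀ z : ℤ, ∃ x, v x = z) ∧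
      (∀ x, 0 ≤ v x ↔ x ∈ V) ∧ ∀ x, 0 < v x ↔ x ∈ V.nonunits := by
  classical
  let val := (IsDiscreteValuationRing.maximalIdeal V).valuation K
  let v : K → WithTop ℤ := fun x ↦ if x = 0 then ⊤ else ((-(val x).log : ℤ) : WithTop ℤ)
  have hv0 : v 0 = ⊤ := if_pos rfl
  have hv {x : K} (hx : x ≠ 0) : v x = ((-(val x).log : ℤ) : WithTop ℤ) := if_neg hx
  have hval {x : K} (hx : x ≠ 0) : val x ≠ 0 := (Valuation.ne_zero_iff _).mpr hx
  have hle (x y : K) : v x ≤ v y ↔ val y ≤ val x := by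
    rcases eq_or_ne y 0 with rfl | hy
    · simp [hv0]
    rcases eq_or_ne x 0 with rfl | hx
    · simp [hv0, hv hy, hval hy]
    rw [hv hx, hv hy, WithTop.coe_le_coe, neg_le_neg_iff, WithZero.log_le_log (hval hy) (hval hx)]
  have hv1 : v 1 = 0 := by simp [hv one_ne_zero]
  have hpos (x : K) : 0 < v x ↔ x ∈ V.nonunits := by
    have hlt : 0 < v x ↔ val x < 1 := by
      rw [← hv1, ← not_le, hle, map_one, not_le]
    rw [hlt, ValuationSubring.mem_nonunits_iff_exists_mem_maximalIdeal]
    constructor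
    · intro h
      have hx : x ∈ V := by
        by_contra hx
        have hinv := (V.mem_or_inv_mem x).resolve_left hx
        have hval_inv : val x⁻¹ ≤ 1 :=
          (IsDiscreteValuationRing.maximalIdeal V).valuation_le_one (K := K) ⟨x⁻¹, hinv⟩
        have hx0 : x ≠ 0 := fun h0 ↦ hx (h0 ▸ V.zero_mem)
        have : val x * val x⁻¹ < 1 := mul_lt_one_of_lt_of_le h hval_inv
        rw [← map_mul, mul_inv_cancel₀ hx0, map_one] at this
        exact lt_irrefl _ this
      exact ⟨hx, ((IsDiscreteValuationRing.maximalIdeal V).valuation_lt_one_iff_mem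
        (K := K) ⟨x, hx⟩).mp h⟩
    · rintro ⟨hx, h⟩
      exact ((IsDiscreteValuationRing.maximalIdeal V).valuation_lt_one_iff_mem
        (K := K) ⟨x, hx⟩).mpr h
  refine ⟨v, hv0, fun x hx ↦ by simp [hv hx], fun x y ↦ ?_, fun x y ↦ ?_, fun z ↦ ?_,
    fun x ↦ ?_, hpos⟩
  · rcases eq_or_ne x 0 with rfl | hx
    · simp [hv0]
    rcases eq_or_ne y 0 with rfl | hy
    · simp [hv0]
    rw [hv hx, hv hy, hv (mul_ne_zero hx hy), map_mul, WithZero.log_mul (hval hx) (hval hy),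
      neg_add, WithTop.coe_add]
  · rw [min_le_iff, hle, hle, ← le_max_iff]
    exact val.map_add x y
  · obtain ⟨x, hx⟩ :=
      (IsDiscreteValuationRing.maximalIdeal V).valuation_surjective K (WithZero.exp (-z))
    have hx0 : x ≠ 0 := by
      rintro rfl
      exact WithZero.exp_ne_zero ((map_zero _).symm.trans hx).symm
    refine ⟨x, ?_⟩
    rw [hv hx0, show val x = _ from hx]
    simp
  · rcases eq_or_ne x 0 with rfl | hx
    · simp [hv0, V.zero_mem]
    have h1 : 0 ≤ v x ↔ ¬ 0 < v x⁻¹ := by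
      rw [hv hx, hv (inv_ne_zero hx), map_inv₀, WithZero.log_inv]
      norm_cast
      omega
    rw [h1, hpos, V.inv_mem_nonunits_iff, or_iff_right hx, not_not]

/-- Points at constant mutual distance give, after a projective change of coordinate sending `P 0`
to infinity, integral elements that are distinct in the residue field. -/
theorem IsPlace.exists_separated {p : ℕ} [Fact p.Prime] {K : Type} [Field K]
    [Algebra (RatFunc (ZMod p)) K] {v : K → WithTop ℤ} (hv : IsPlace p K v) {n : ℕ} (hn : 2 ≤ n)
    (P : ℕ → K × K) (hPne : ∀ i, i < n → P i ≠ (0, 0))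
    (hPdist : ∀ i j, i < n → j < n → i ≠ j → ¬∃ c : K, c ≠ 0 ∧ P i = c • P j)
    (hdist : ∀ i j, i < n → j < n → i ≠ j → logDist v (P 0) (P 1) = logDist v (P i) (P j)) :
    ∃ w : Fin (n - 1) → K, (∀ i, 0 ≤ v (w i)) ∧ ∀ i j, i ≠ j → v (w i - w j) = 0 := by
  obtain ⟨hv0, hvtop, hvmul, -, -, hvsurj⟩ := hv
  let Δ (i j : ℕ) : K := (P i).1 * (P j).2 - (P j).1 * (P i).2
  have hΔ0 {i j : ℕ} (hi : i < n) (hj : j < n) (hij : i ≠ j) : Δ i j ≠ 0 := by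
    intro h
    simp only [Δ] at h
    apply hPdist i j hi hj hij
    have hi0 := hPne i hi
    have hj0 := hPne j hj
    rw [Ne, Prod.ext_iff, not_and_or] at hi0 hj0
    by_cases hx : (P j).1 = 0
    · have hy : (P j).2 ≠ 0 := by simpa [hx] using hj0
      have hix : (P i).1 = 0 := by simpa [hx, hy] using h
      have hiy : (P i).2 ≠ 0 := by simpa [hix] using hi0
      refine ⟨(P i).2 / (P j).2, div_ne_zero hiy hy, Prod.ext ?_ ?_⟩
      · simp [hx, hix]
      · simp [hy]
    · have hix : (P i).1 ≠ 0 := by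
        intro hix
        have hiy : (P i).2 = 0 := by simpa [hx, hix] using h
        simp [hix, hiy] at hi0
      refine ⟨(P i).1 / (P j).1, div_ne_zero hix hx, Prod.ext ?_ ?_⟩
      · simp [hx]
      · simp only [Prod.smul_snd, smul_eq_mul]
        field_simp
        linear_combination -h
  have hm : ∀ i, ∃ m : ℤ, i < n → min (v (P i).1) (v (P i).2) = m := by
    intro i
    by_cases hi : i < n
    · have hi0 := hPne i hi
      have htop : min (v (P i).1) (v (P i).2) ≠ ⊤ := by
        rw [Ne, min_eq_top, not_and_or]
        rw [Ne, Prod.ext_iff, not_and_or] at hi0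
        exact hi0.imp (hvtop _) (hvtop _)
      obtain ⟨m, hm⟩ := WithTop.ne_top_iff_exists.mp htop
      exact ⟨m, fun _ ↦ hm.symm⟩
    · exact ⟨0, fun h ↦ absurd h hi⟩
  choose m hm using hm
  have hlog {i j : ℕ} (hi : i < n) (hj : j < n) {a : ℤ} (ha : v (Δ i j) = a) :
      logDist v (P i) (P j) = ((a - m i - m j : ℤ) : WithTop ℤ) := by
    rw [logDist, hm i hi, hm j hj, show v _ = _ from ha]
    norm_cast
  have h0 : 0 < n := by omega
  have h1 : 1 < n := by omega
  obtain ⟨a₀, ha₀⟩ := WithTop.ne_top_iff_exists.mp (hvtop _ (hΔ0 h0 h1 zero_ne_one))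
  have hΔ {i j : ℕ} (hi : i < n) (hj : j < n) (hij : i ≠ j) :
      v (Δ i j) = ((a₀ - m 0 - m 1 + m i + m j : ℤ) : WithTop ℤ) := by
    obtain ⟨a, ha⟩ := WithTop.ne_top_iff_exists.mp (hvtop _ (hΔ0 hi hj hij))
    have h := hdist i j hi hj hij
    rw [hlog h0 h1 ha₀.symm, hlog hi hj ha.symm, WithTop.coe_inj] at h
    rw [← ha, WithTop.coe_inj]
    omega
  have hcancel {x b c : K} {β γ : ℤ} (hx : x * b = c) (hb : v b = β) (hc : v c = γ) :
      v x = ((γ - β : ℤ) : WithTop ℤ) := by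
    have h := hvmul x b
    rw [hx, hb, hc] at h
    cases hvx : v x with
    | top => simp [hvx] at h
    | coe k =>
      rw [hvx] at h
      norm_cast at h ⊢
      omega
  obtain ⟨u, hu⟩ := hvsurj (m 0 - m 1)
  refine ⟨fun i ↦ u * Δ (i + 1) 1 / Δ (i + 1) 0, fun i ↦ ?_, fun i j hij ↦ ?_⟩
  · have hi : (i : ℕ) + 1 < n := by omega
    have hne := hΔ0 hi h0 (by omega)
    rcases eq_or_ne (i : ℕ) 0 with hi0 | hi0
    · have : Δ (i + 1) 1 = 0 := by simp only [Δ, hi0, zero_add]; ring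
      simp [this, hv0]
    · have := hcancel (div_mul_cancel₀ _ hne) (hΔ hi h0 (by omega))
        ((hvmul u (Δ (i + 1) 1)).trans (by rw [hu, hΔ hi h1 (by omega), ← WithTop.coe_add]))
      rw [this]
      norm_cast
      omega
  · have hi : (i : ℕ) + 1 < n := by omega
    have hj : (j : ℕ) + 1 < n := by omega
    have hij' : (i : ℕ) + 1 ≠ j + 1 := by simpa [Fin.ext_iff] using hij
    have hi0 := hΔ0 hi h0 (by omega)
    have hj0 := hΔ0 hj h0 (by omega)
    have hprod : (u * Δ (i + 1) 1 / Δ (i + 1) 0 - u * Δ (j + 1) 1 / Δ (j + 1) 0) *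
        (Δ (i + 1) 0 * Δ (j + 1) 0) = u * (Δ (i + 1) (j + 1) * Δ 1 0) := by
      field_simp
      simp only [Δ]
      ring
    have := hcancel hprod
      ((hvmul _ _).trans (by rw [hΔ hi h0 (by omega), hΔ hj h0 (by omega), ← WithTop.coe_add]))
      ((hvmul _ _).trans (by
        rw [hvmul, hu, hΔ hi hj hij', hΔ h1 h0 (by omega), ← WithTop.coe_add, ← WithTop.coe_add]))
    rw [this]
    norm_cast
    omega

/-- Every monic irreducible polynomial extends to a place of `K` whose residue field has degree
at most `[K : F_p(t)]` over the residue field of the polynomial. -/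
theorem exists_isPlace {p : ℕ} [Fact p.Prime] {K : Type} [Field K]
    [Algebra (RatFunc (ZMod p)) K] [FiniteDimensional (RatFunc (ZMod p)) K]
    {f : (ZMod p)[X]} (hmonic : f.Monic) (hirr : Irreducible f) :
    ∃ v : K → WithTop ℤ, IsPlace p K v ∧
      (∀ g : (ZMod p)[X], 0 ≤ v (algebraMap (RatFunc (ZMod p)) K (algebraMap _ _ g))) ∧
      0 < v (algebraMap (RatFunc (ZMod p)) K (algebraMap _ _ f)) ∧
      ∀ {N : ℕ} (w : Fin N → K), (∀ i, 0 ≤ v (w i)) →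
        (∀ i j, i ≠ j → v (w i - w j) = 0) →
        N ≤ (p ^ f.natDegree) ^ Module.finrank (RatFunc (ZMod p)) K := by
  let : Algebra (ZMod p)[X] K :=
    ((algebraMap (RatFunc (ZMod p)) K).comp (algebraMap (ZMod p)[X] (RatFunc (ZMod p)))).toAlgebra
  have : IsScalarTower (ZMod p)[X] (RatFunc (ZMod p)) K := .of_algebraMap_eq fun _ ↦ rfl
  have : Module.Finite (ZMod p) ((ZMod p)[X] ⧸ Ideal.span {f}) :=
    (AdjoinRoot.powerBasis hmonic.ne_zero).finite
  have : Finite ((ZMod p)[X] ⧸ Ideal.span {f}) := Module.finite_of_finite (ZMod p)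
  have hcard : Nat.card ((ZMod p)[X] ⧸ Ideal.span {f}) = p ^ f.natDegree := by
    rw [Module.natCard_eq_pow_finrank (K := ZMod p), Nat.card_zmod,
      finrank_quotient_span_eq_natDegree]
  obtain ⟨V, hV, hAV, hfV, hfin, hle⟩ :=
    exists_discrete_valuationSubring (F := RatFunc (ZMod p)) (K := K) hirr.prime
  obtain ⟨v, hv0, hvtop, hvmul, hvadd, hvsurj, hvV, hvpos⟩ := V.exists_addValuation
  have hint (g : (ZMod p)[X]) : 0 ≤ v (algebraMap (RatFunc (ZMod p)) K (algebraMap _ _ g)) :=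
    (hvV _).mpr (hAV g)
  have hv1 : v 1 = 0 := by
    obtain ⟨k, hk⟩ := WithTop.ne_top_iff_exists.mp (hvtop 1 one_ne_zero)
    have h := hvmul 1 1
    rw [mul_one, ← hk] at h
    norm_cast at h
    rw [← hk]
    norm_cast
    omega
  refine ⟨v, ⟨hv0, hvtop, hvmul, hvadd, fun c hc ↦ ?_, hvsurj⟩, hint, (hvpos _).mpr hfV,
    fun {N} w hw hww ↦ ?_⟩
  · have h := hvmul (algebraMap (RatFunc (ZMod p)) K (RatFunc.C c))
      (algebraMap (RatFunc (ZMod p)) K (RatFunc.C c⁻¹))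
    rw [← map_mul, ← map_mul, mul_inv_cancel₀ hc, map_one, map_one, hv1] at h
    have hc' := hint (Polynomial.C c)
    have hci := hint (Polynomial.C c⁻¹)
    rw [RatFunc.algebraMap_C] at hc' hci
    exact ((add_eq_zero_iff_of_nonneg hc' hci).mp h.symm).1
  · let r (i : Fin N) : IsLocalRing.ResidueField V :=
      IsLocalRing.residue V ⟨w i, (hvV _).mp (hw i)⟩
    have hr : Function.Injective r := by
      intro i j hij
      by_contra hne
      rw [← sub_eq_zero, ← map_sub, IsLocalRing.residue_eq_zero_iff,
        ← ValuationSubring.coe_mem_nonunits_iff, ← hvpos] at hij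
      exact hij.ne' (hww i j hne)
    have := Nat.card_le_card_of_injective r hr
    rw [Nat.card_fin] at this
    rw [← hcard]
    exact this.trans hle

/-- Let `K` be a function field of degree `D` over `F_p(t)` and `S` a nonempty finite
set of places of `K`.  If `P₀, …, P_{n−1} ∈ ℙ¹(K)` are `n` distinct points such that
`δ_v(P₀,P₁) = δ_v(P_i,P_j)` for all distinct `0 ≤ i, j ≤ n−1` and all places
`v ∉ S`, then `n ≤ (p·|S|)^{2D}`. -/
theorem card_le_of_equal_logDist (p : ℕ) [Fact p.Prime]
    (K : Type) [Field K] [Algebra (RatFunc (ZMod p)) K]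
    [FiniteDimensional (RatFunc (ZMod p)) K]
    (S : Finset (K → WithTop ℤ)) (hSne : S.Nonempty)
    (hSpl : ∀ v ∈ S, IsPlace p K v)
    (n : ℕ) (P : ℕ → K × K)
    (hPne : ∀ i, i < n → P i ≠ (0, 0))
    (hPdist : ∀ i j, i < n → j < n → i ≠ j →
      ¬∃ c : K, c ≠ 0 ∧ P i = c • P j)
    (hdist : ∀ v : K → WithTop ℤ, IsPlace p K v → v ∉ S →
      ∀ i j, i < n → j < n → i ≠ j → logDist v (P 0) (P 1) = logDist v (P i) (P j)) :
    n ≤ (p * S.card) ^ (2 * Module.finrank (RatFunc (ZMod p)) K) := by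
  have hp : 2 ≤ p := (Fact.out : p.Prime).two_le
  have hs : 0 < S.card := hSne.card_pos
  have hD : Module.finrank (RatFunc (ZMod p)) K ≠ 0 := Module.finrank_pos.ne'
  rcases Nat.lt_or_ge n 2 with hn | hn
  · exact (Nat.le_of_lt_succ hn).trans (Nat.one_le_pow _ _ (by positivity))
  obtain ⟨d, hd0, hds, hdp⟩ := exists_mul_lt_pow_lt_sq hp hs
  obtain ⟨T, hTS, hT⟩ := exists_card_lt_irreducible_natDegree_le p hd0 hds
  choose! v hv hint hpos hres using fun f hf ↦ exists_isPlace (p := p) (K := K) (f := f)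
    (hT f hf).1 (hT f hf).2.1
  have hinj : Set.InjOn v T := by
    intro f hf g hg hfg
    by_contra hne
    have hcop : IsCoprime f g := by
      refine (hT f hf).2.1.coprime_iff_not_dvd.mpr fun hdvd ↦ hne ?_
      exact Polynomial.eq_of_monic_of_associated (hT f hf).1 (hT g hg).1
        ((hT f hf).2.1.associated_of_dvd (hT g hg).2.1 hdvd)
    obtain ⟨a, b, hab⟩ := hcop
    obtain ⟨-, -, hmul, hadd, hconst, -⟩ := hv f hf
    have h1 : v f 1 = 0 := by simpa using hconst 1 one_ne_zero
    have hgpos := hpos g hg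
    rw [← hfg] at hgpos
    have hle := hadd (algebraMap (RatFunc (ZMod p)) K (algebraMap _ _ (a * f)))
      (algebraMap (RatFunc (ZMod p)) K (algebraMap _ _ (b * g)))
    rw [← map_add, ← map_add, hab, map_one, map_one, h1] at hle
    refine not_lt_of_ge hle (lt_min ?_ ?_)
    · rw [map_mul, map_mul, hmul]
      exact (hpos f hf).trans_le (le_add_of_nonneg_left (hint f hf a))
    · rw [map_mul, map_mul, hmul]
      exact hgpos.trans_le (le_add_of_nonneg_left (hint f hf b))
  obtain ⟨f, hf, hfS⟩ : ∃ f ∈ T, v f ∉ S := by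
    by_contra! h
    exact hTS.not_ge (Finset.card_le_card_of_injOn v h hinj)
  obtain ⟨w, hw, hww⟩ := (hv f hf).exists_separated hn P hPne hPdist
    (hdist (v f) (hv f hf) hfS)
  have hcard := hres f hf w hw hww
  have hpow : (p ^ f.natDegree) ^ Module.finrank (RatFunc (ZMod p)) K <
      (p * S.card) ^ (2 * Module.finrank (RatFunc (ZMod p)) K) := by
    rw [pow_mul]
    exact Nat.pow_lt_pow_left
      ((Nat.pow_le_pow_right (by omega) (hT f hf).2.2).trans_lt hdp) hD
  omega
end
end
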